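/- Every finite simple loopless digraph G on n ≥ 1 vertices has a dominating set of size at most α(G)·⌈log₂(n+1)⌉, where α(G) is the independence number of the underlying undirected graph. In particular γ(G) ≤ α(G)·log₂ n up to rounding. -/

import Mathlib

open Finset
open scoped Classical

/-- In a nonempty finite digraph some vertex has out-degree at least its in-degree. -/
theorem exists_indegree_le_outdegree {V : Type*} (E : V → V → Prop) {U : Finset V}
    (hU : U.Nonempty) :
    ∃ v ∈ U, #{u ∈ U | E u v} ≤ #{u ∈ U | E v u} := by
  by_contra! h
  have hlt := Finset.sum_lt_sum_of_nonempty hU h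
  have heq := Finset.sum_card_bipartiteAbove_eq_sum_card_bipartiteBelow (s := U) (t := U) E
  simp only [Finset.bipartiteAbove, Finset.bipartiteBelow] at heq
  omega

/-- Some independent set dominates more than half of the vertices. -/
theorem exists_independent_half_dominating {V : Type*} (E : V → V → Prop)
    (hirr : Irreflexive E) (hsimple : ∀ u v, E u v → ¬ E v u) (U : Finset V) :
    ∃ S ⊆ U, (∀ u ∈ S, ∀ w ∈ S, u ≠ w → ¬ E u w) ∧
      2 * #{v ∈ U | v ∉ S ∧ ∀ u ∈ S, ¬ E u v} + #S ≤ #U := by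
  induction U using Finset.strongInduction with
  | H U ih =>
  rcases U.eq_empty_or_nonempty with rfl | hU
  · exact ⟨∅, by simp⟩
  obtain ⟨v, hv, hdeg⟩ := exists_indegree_le_outdegree E hU
  set W := {u ∈ U | u ≠ v ∧ ¬ E v u ∧ ¬ E u v} with hW
  have hvW : v ∉ W := by simp [hW]
  obtain ⟨S, hSW, hind, hcard⟩ := ih W
    (Finset.ssubset_iff_subset_ne.2 ⟨Finset.filter_subset _ _, fun h => hvW (h ▸ hv)⟩)
  have hvS : v ∉ S := fun h => hvW (hSW h)
  have hS : ∀ u ∈ S, u ∈ U ∧ u ≠ v ∧ ¬ E v u ∧ ¬ E u v := fun u hu => by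
    simpa [hW] using hSW hu
  refine ⟨insert v S, ?_, ?_, ?_⟩
  · intro u hu
    rcases Finset.mem_insert.1 hu with rfl | hu
    exacts [hv, (hS u hu).1]
  · intro u hu w hw huw
    rcases Finset.mem_insert.1 hu with rfl | huS <;> rcases Finset.mem_insert.1 hw with rfl | hwS
    exacts [absurd rfl huw, (hS w hwS).2.2.1, (hS u huS).2.2.2, hind u huS w hwS huw]
  · have hundom : #{x ∈ U | x ∉ insert v S ∧ ∀ u ∈ insert v S, ¬ E u x} ≤
        #{u ∈ U | E u v} + #{x ∈ W | x ∉ S ∧ ∀ u ∈ S, ¬ E u x} := by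
      refine (Finset.card_le_card fun x hx => ?_).trans (Finset.card_union_le _ _)
      simp only [hW, Finset.mem_union, Finset.mem_filter, Finset.mem_insert] at hx ⊢
      grind
    have hdisj : Disjoint {u ∈ U | E u v} {u ∈ U | E v u} :=
      Finset.disjoint_filter.2 fun u _ h => hsimple u v h
    have hdisjW : Disjoint ({u ∈ U | E u v} ∪ {u ∈ U | E v u}) W := by
      rw [Finset.disjoint_left]
      intro x hx
      simp only [hW, Finset.mem_union, Finset.mem_filter] at hx ⊢
      tauto
    have hpart : insert v (({u ∈ U | E u v} ∪ {u ∈ U | E v u}) ∪ W) ⊆ U := by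
      intro x hx
      simp only [hW, Finset.mem_insert, Finset.mem_union, Finset.mem_filter] at hx
      grind
    have hle := Finset.card_le_card hpart
    rw [Finset.card_insert_of_notMem (by simp [hW, hirr v]), Finset.card_union_of_disjoint hdisjW,
      Finset.card_union_of_disjoint hdisj] at hle
    rw [Finset.card_insert_of_notMem hvS]
    omega

/-- If independent sets have at most `a` elements, then fewer than `2 ^ k` vertices are dominated
by `a * k` vertices. -/
theorem exists_dominating_card_le {V : Type*} (E : V → V → Prop)
    (hirr : Irreflexive E) (hsimple : ∀ u v, E u v → ¬ E v u) (a : ℕ)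
    (ha : ∀ S : Finset V, (∀ u ∈ S, ∀ w ∈ S, u ≠ w → ¬ E u w) → #S ≤ a)
    (k : ℕ) (U : Finset V) (hU : #U < 2 ^ k) :
    ∃ D : Finset V, (∀ v ∈ U, v ∈ D ∨ ∃ u ∈ D, E u v) ∧ #D ≤ a * k := by
  induction k generalizing U with
  | zero => exact ⟨∅, by simp_all⟩
  | succ k ih =>
    obtain ⟨S, -, hind, hcard⟩ := exists_independent_half_dominating E hirr hsimple U
    obtain ⟨D, hD, hDcard⟩ := ih {v ∈ U | v ∉ S ∧ ∀ u ∈ S, ¬ E u v} (by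
      rw [pow_succ] at hU
      omega)
    refine ⟨S ∪ D, fun v hv => ?_, ?_⟩
    · by_cases h : v ∉ S ∧ ∀ u ∈ S, ¬ E u v
      · rcases hD v (Finset.mem_filter.2 ⟨hv, h⟩) with hvD | ⟨u, hu, huv⟩
        exacts [Or.inl (Finset.mem_union_right _ hvD), Or.inr ⟨u, Finset.mem_union_right _ hu, huv⟩]
      · rw [not_and_or, not_not] at h
        push Not at h
        rcases h with hvS | ⟨u, hu, huv⟩
        exacts [Or.inl (Finset.mem_union_left _ hvS), Or.inr ⟨u, Finset.mem_union_left _ hu, huv⟩]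
    · have := Finset.card_union_le S D
      have := ha S hind
      rw [mul_add_one]
      omega

/-- Every finite simple loopless digraph on `n ≥ 1` vertices has a dominating set of size
at most `α(G)·⌈log₂(n+1)⌉`. -/
theorem domination_le_indepNum_mul_log
    {V : Type*} [Fintype V] [Nonempty V] (E : V → V → Prop)
    (hirr : Irreflexive E) (hsimple : ∀ u v, E u v → ¬ E v u)
    (a : ℕ)
    (ha : IsGreatest {n : ℕ | ∃ S : Finset V,
        (∀ u ∈ S, ∀ w ∈ S, u ≠ w → ¬ E u w) ∧ S.card = n} a) :
    ∃ D : Finset V,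
      (∀ v : V, v ∈ D ∨ ∃ u ∈ D, E u v) ∧
      D.card ≤ a * Nat.clog 2 (Fintype.card V + 1) := by
  obtain ⟨D, hD, hcard⟩ := exists_dominating_card_le E hirr hsimple a
    (fun S hS => ha.2 ⟨S, hS, rfl⟩) (Nat.clog 2 (Fintype.card V + 1)) Finset.univ
    (Nat.le_pow_clog one_lt_two _)
  exact ⟨D, fun v => hD v (Finset.mem_univ v), hcard⟩
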